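/- The multigraded Hilbert function of R/M_4 is W_4-invariant: for every g ∈ W_4 and every D ∈ ℤ^5, dim_k (R/M_4)_D = dim_k (R/M_4)_{g(D)}. -/

import Mathlib

open MvPolynomial

/- The polynomial ring `R = k[e₁,e₂,e₃,e₄,f₁₂,f₁₃,f₁₄,f₂₃,f₂₄,f₃₄]` is modelled as
`MvPolynomial (Fin 10) k`, with `e₁ = X 0, e₂ = X 1, e₃ = X 2, e₄ = X 3`,
`f₁₂ = X 4, f₁₃ = X 5, f₁₄ = X 6, f₂₃ = X 7, f₂₄ = X 8, f₃₄ = X 9`.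
The grading group is `ℤ⁵` with basis `ℓ, ε₁, ε₂, ε₃, ε₄` (coordinate 0 is the
`ℓ`-coordinate); `deg eᵢ = εᵢ`, `deg fᵢⱼ = ℓ − εᵢ − εⱼ`. -/
def deg4 : Fin 10 → Fin 5 → ℤ :=
  ![![0,1,0,0,0], ![0,0,1,0,0], ![0,0,0,1,0], ![0,0,0,0,1],
    ![1,-1,-1,0,0], ![1,-1,0,-1,0], ![1,-1,0,0,-1],
    ![1,0,-1,-1,0], ![1,0,-1,0,-1], ![1,0,0,-1,-1]]

/-- The ideal `Q₄` generated by the five quadric relations among the distinguished sections of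
the conic bundles on the degree-5 Del Pezzo surface. -/
noncomputable def Q4 (k : Type*) [Field k] : Ideal (MvPolynomial (Fin 10) k) :=
  Ideal.span
    {X 6 * X 7 - X 4 * X 9 - X 5 * X 8,
     X 1 * X 4 - X 2 * X 5 - X 3 * X 6,
     X 0 * X 4 - X 2 * X 7 - X 3 * X 8,
     X 0 * X 5 - X 1 * X 7 + X 3 * X 9,
     X 0 * X 6 - X 1 * X 8 - X 2 * X 9}

/-- The monomial ideal `M₄ = (f₂₃f₁₄, e₁f₁₄, e₁f₁₃, e₂f₁₂, e₁f₁₂)`. -/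
noncomputable def M4 (k : Type*) [Field k] : Ideal (MvPolynomial (Fin 10) k) :=
  Ideal.span {X 7 * X 6, X 0 * X 6, X 0 * X 5, X 1 * X 4, X 0 * X 4}

/-- The `P`-degree of a monomial for the grading `deg`. -/
def mdeg {n : ℕ} {P : Type*} [AddCommMonoid P] (deg : Fin n → P) (a : Fin n →₀ ℕ) : P :=
  a.sum fun i e => e • deg i

/-- The `k`-span of the monomials of degree `D`. -/
noncomputable def degSub {k : Type*} [Field k] {n : ℕ} {P : Type*} [AddCommMonoid P]
    (deg : Fin n → P) (D : P) : Submodule k (MvPolynomial (Fin n) k) :=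
  Submodule.span k
    ((fun a => (monomial a (1 : k) : MvPolynomial (Fin n) k)) '' { a | mdeg deg a = D })

/-- The degree-`D` piece `(R/Q)_D` of the quotient. -/
noncomputable def quotPiece {k : Type*} [Field k] {n : ℕ} {P : Type*} [AddCommMonoid P]
    (Q : Ideal (MvPolynomial (Fin n) k)) (deg : Fin n → P) (D : P) :
    Submodule k (MvPolynomial (Fin n) k ⧸ Submodule.restrictScalars k Q) :=
  Submodule.map (Submodule.restrictScalars k Q).mkQ (degSub deg D)

/-- The matrix (in the basis `ℓ, ε₁, …, ε₄`) of the Cremona element `σ`: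
`σ(ℓ) = 2ℓ−ε₁−ε₂−ε₃`, `σ(ε₁) = ℓ−ε₂−ε₃`, `σ(ε₂) = ℓ−ε₁−ε₃`, `σ(ε₃) = ℓ−ε₁−ε₂`,
`σ(ε₄) = ε₄`. -/
def sigM4 : Matrix (Fin 5) (Fin 5) ℤ :=
  !![2,1,1,1,0; -1,0,-1,-1,0; -1,-1,0,-1,0; -1,-1,-1,0,0; 0,0,0,0,1]

lemma sigM4_sq : sigM4 * sigM4 = 1 := by decide

/-- The Cremona element as an automorphism of `ℤ⁵`. -/
noncomputable def cremona4 : (Fin 5 → ℤ) ≃ₗ[ℤ] (Fin 5 → ℤ) :=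
  LinearEquiv.ofLinear (Matrix.toLin' sigM4) (Matrix.toLin' sigM4)
    (by rw [← Matrix.toLin'_mul, sigM4_sq, Matrix.toLin'_one])
    (by rw [← Matrix.toLin'_mul, sigM4_sq, Matrix.toLin'_one])

/-- The Weyl group `W₄ ⊆ GL₅(ℤ)`: generated by the coordinate permutations fixing `ℓ` and
permuting `ε₁,…,ε₄`, together with the Cremona element `σ`. -/
noncomputable def W4 : Subgroup ((Fin 5 → ℤ) ≃ₗ[ℤ] (Fin 5 → ℤ)) :=
  Subgroup.closure ({cremona4} ∪
    { e | ∃ π : Equiv.Perm (Fin 5), π 0 = 0 ∧ e = LinearEquiv.funCongrLeft ℤ ℤ π })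

/-- An exponent vector is standard if its monomial is divisible by no generator of `M4`. -/
def IsStd (a : Fin 10 →₀ ℕ) : Prop :=
  (a 7 = 0 ∨ a 6 = 0) ∧ (a 0 = 0 ∨ a 6 = 0) ∧ (a 0 = 0 ∨ a 5 = 0) ∧ (a 1 = 0 ∨ a 4 = 0) ∧
    (a 0 = 0 ∨ a 4 = 0)

/-- The standard monomials of degree `D`. -/
abbrev StdMon (D : Fin 5 → ℤ) : Type := {a : Fin 10 →₀ ℕ // IsStd a ∧ mdeg deg4 a = D}

lemma mem_M4_iff {k : Type*} [Field k] (p : MvPolynomial (Fin 10) k) :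
    p ∈ M4 k ↔ ∀ a ∈ p.support, ¬ IsStd a := by
  have hpair (i j : Fin 10) : (X i * X j : MvPolynomial (Fin 10) k) =
      monomial (Finsupp.single i 1 + Finsupp.single j 1) 1 := by
    simp [X, monomial_mul]
  have hle {i j : Fin 10} (hij : i ≠ j) (a : Fin 10 →₀ ℕ) :
      Finsupp.single i 1 + Finsupp.single j 1 ≤ a ↔ ¬ (a i = 0 ∨ a j = 0) := by
    rw [Finsupp.le_def]
    constructor
    · intro h
      have h₁ := h i
      have h₂ := h j
      simp [hij, hij.symm] at h₁ h₂
      omega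
    · intro h l
      simp only [Finsupp.add_apply, Finsupp.single_apply]
      split_ifs with h₁ h₂ h₂
      · exact absurd (h₁.trans h₂.symm) hij
      all_goals grind
  have hM : M4 k = Ideal.span ((fun s => monomial s (1 : k)) ''
      {Finsupp.single 7 1 + Finsupp.single 6 1, Finsupp.single 0 1 + Finsupp.single 6 1,
        Finsupp.single 0 1 + Finsupp.single 5 1, Finsupp.single 1 1 + Finsupp.single 4 1,
        Finsupp.single 0 1 + Finsupp.single 4 1}) := by
    simp only [M4, hpair, Set.image_insert_eq, Set.image_singleton]
  rw [hM, mem_ideal_span_monomial_image]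
  refine forall₂_congr fun a _ => ?_
  simp only [Set.mem_insert_iff, Set.mem_singleton_iff, exists_eq_or_imp, exists_eq_left, IsStd]
  rw [hle (by decide), hle (by decide), hle (by decide), hle (by decide), hle (by decide)]
  tauto

/-- The dimension of a graded piece of `R/M₄` counts standard monomials. -/
lemma finrank_quotPiece_M4 {k : Type*} [Field k] (D : Fin 5 → ℤ) :
    Module.finrank k (quotPiece (M4 k) deg4 D) = Nat.card (StdMon D) := by
  let q := (Submodule.restrictScalars k (M4 k)).mkQ
  let m : StdMon D → MvPolynomial (Fin 10) k := fun a => monomial a.1 1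
  have hspan : quotPiece (M4 k) deg4 D = Submodule.span k (Set.range (q ∘ m)) := by
    rw [quotPiece, degSub, Submodule.map_span]
    apply le_antisymm
    · rw [Submodule.span_le]
      rintro _ ⟨_, ⟨a, ha, rfl⟩, rfl⟩
      by_cases hs : IsStd a
      · exact Submodule.subset_span ⟨⟨a, hs, ha⟩, rfl⟩
      · have h0 : (Submodule.restrictScalars k (M4 k)).mkQ (monomial a 1) = 0 := by
          rw [Submodule.mkQ_apply, Submodule.Quotient.mk_eq_zero, Submodule.restrictScalars_mem,
            mem_M4_iff]
          intro b hb
          rw [Finset.mem_singleton.1 (support_monomial_subset hb)]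
          exact hs
        simp only [SetLike.mem_coe]
        rw [h0]
        exact Submodule.zero_mem _
    · apply Submodule.span_mono
      rintro _ ⟨a, rfl⟩
      exact ⟨_, ⟨a.1, a.2.2, rfl⟩, rfl⟩
  have hm : LinearIndependent k m := by
    have := (basisMonomials (Fin 10) k).linearIndependent.comp
      (Subtype.val : StdMon D → Fin 10 →₀ ℕ) Subtype.val_injective
    rwa [coe_basisMonomials] at this
  have hq : LinearIndependent k (q ∘ m) := by
    refine hm.map ?_
    rw [Submodule.ker_mkQ, Submodule.disjoint_def]
    intro x hx hxM
    rw [Submodule.restrictScalars_mem, mem_M4_iff] at hxM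
    have hsup : x ∈ restrictSupport k {a | IsStd a} := by
      refine Submodule.span_le.2 ?_ hx
      rintro _ ⟨a, rfl⟩
      rw [SetLike.mem_coe, mem_restrictSupport_iff]
      intro b hb
      rw [Finset.mem_singleton.1 (support_monomial_subset hb)]
      exact a.2.1
    rw [mem_restrictSupport_iff] at hsup
    rw [← support_eq_empty, Finset.eq_empty_iff_forall_notMem]
    exact fun a ha => hxM a ha (hsup ha)
  rw [hspan]
  exact Module.finrank_eq_nat_card_basis (Module.Basis.span hq)

lemma mdeg_deg4_eq_iff (a : Fin 10 →₀ ℕ) (D : Fin 5 → ℤ) :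
    mdeg deg4 a = D ↔
      (a 4 + a 5 + a 6 + a 7 + a 8 + a 9 : ℤ) = D 0 ∧ (a 0 - a 4 - a 5 - a 6 : ℤ) = D 1 ∧
      (a 1 - a 4 - a 7 - a 8 : ℤ) = D 2 ∧ (a 2 - a 5 - a 7 - a 9 : ℤ) = D 3 ∧
      (a 3 - a 6 - a 8 - a 9 : ℤ) = D 4 := by
  rw [mdeg, Finsupp.sum_fintype _ _ (by simp), funext_iff]
  simp only [Fin.forall_fin_succ, Fin.sum_univ_succ, Finset.sum_apply]
  simp [deg4]
  constructor <;> intro h <;> omega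

/-- The lattice points `(u, v)` recording two-row semistandard tableaux with entries in
`{1, …, 5}` whose content is determined by `D`: the second row has `u` entries at most `2` and `v`
entries at most `3`. -/
def tableaux (D : Fin 5 → ℤ) : Set (ℤ × ℤ) :=
  {p | 0 ≤ p.1 ∧ p.1 ≤ D 0 + D 1 ∧ p.1 ≤ D 0 + D 2 ∧ p.1 ≤ p.2 ∧
    p.2 ≤ 2 * D 0 + D 1 + D 2 - p.1 ∧ p.2 - p.1 ≤ D 0 + D 3 ∧ p.2 ≤ D 0 ∧
    p.2 ≤ 2 * D 0 + D 1 + D 2 + D 3 ∧ -D 4 ≤ p.2 ∧ 0 ≤ 2 * D 0 + D 1 + D 2 + D 3 + D 4}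

/-- Standard monomials correspond to two-row semistandard tableaux, the variables being the
possible columns. -/
lemma card_stdMon (D : Fin 5 → ℤ) : Nat.card (StdMon D) = Nat.card (tableaux D) := by
  have hmem (a : StdMon D) : ((a.1 9 : ℤ), (a.1 9 + a.1 8 + a.1 6 : ℤ)) ∈ tableaux D := by
    obtain ⟨a, ⟨h1, h2, h3, h4, h5⟩, hD⟩ := a
    rw [mdeg_deg4_eq_iff] at hD
    simp only [tableaux, Set.mem_ofPred_eq]
    omega
  refine Nat.card_eq_of_bijective (fun a => ⟨_, hmem a⟩) ⟨?_, ?_⟩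
  · rintro ⟨a, ha, hD⟩ ⟨b, hb, gD⟩ h
    simp only [Subtype.mk.injEq, Prod.mk.injEq] at h
    rw [mdeg_deg4_eq_iff] at hD gD
    rw [Subtype.mk.injEq]
    obtain ⟨a1, a2, a3, a4, a5⟩ := ha
    obtain ⟨b1, b2, b3, b4, b5⟩ := hb
    have h6 : a 6 = b 6 := by clear a3 a4 a5 b3 b4 b5; omega
    clear a1 a2 b1 b2
    have h0 : a 0 = b 0 := by clear a4 b4; omega
    clear a3 a5 b3 b5
    have h4 : a 4 = b 4 := by omega
    clear a4 b4
    ext i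
    fin_cases i <;> simp only [Fin.zero_eta, Fin.mk_one, Fin.reduceFinMk] <;> omega
  · rintro ⟨⟨u, v⟩, h⟩
    simp only [tableaux, Set.mem_ofPred_eq] at h
    obtain ⟨r, hr⟩ : ∃ r, r = 2 * D 0 + D 1 + D 2 - u := ⟨_, rfl⟩
    obtain ⟨x, hx⟩ : ∃ x, x = min (D 0 + D 1) v := ⟨_, rfl⟩
    obtain ⟨y, hy⟩ : ∃ y, y = min (D 0 + D 1) (D 0) := ⟨_, rfl⟩
    obtain ⟨z, hz⟩ : ∃ z, z = min r (D 0) := ⟨_, rfl⟩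
    lift u to ℕ using h.1
    obtain ⟨a₀, h₀⟩ := Int.eq_ofNat_of_zero_le (a := D 0 + D 1 - y) (by omega)
    obtain ⟨a₁, h₁⟩ := Int.eq_ofNat_of_zero_le (a := r - D 0 - D 1 + y - z) (by omega)
    obtain ⟨a₂, h₂⟩ := Int.eq_ofNat_of_zero_le
      (a := 2 * D 0 + D 1 + D 2 + D 3 - v - r + z) (by omega)
    obtain ⟨a₃, h₃⟩ := Int.eq_ofNat_of_zero_le (a := D 4 + v) (by omega)
    obtain ⟨a₄, h₄⟩ := Int.eq_ofNat_of_zero_le (a := D 0 - z) (by omega)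
    obtain ⟨a₅, h₅⟩ := Int.eq_ofNat_of_zero_le (a := z - v - y + x) (by omega)
    obtain ⟨a₆, h₆⟩ := Int.eq_ofNat_of_zero_le (a := v - x) (by omega)
    obtain ⟨a₇, h₇⟩ := Int.eq_ofNat_of_zero_le (a := y - x) (by omega)
    obtain ⟨a₈, h₈⟩ := Int.eq_ofNat_of_zero_le (a := x - u) (by omega)
    refine ⟨⟨Finsupp.equivFunOnFinite.symm ![a₀, a₁, a₂, a₃, a₄, a₅, a₆, a₇, a₈, u], ?_, ?_⟩, ?_⟩
    · simp only [IsStd, Finsupp.equivFunOnFinite_symm_apply_apply, Matrix.cons_val]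
      refine ⟨?_, ?_, ?_, ?_, ?_⟩ <;> omega
    · rw [mdeg_deg4_eq_iff]
      simp only [Finsupp.equivFunOnFinite_symm_apply_apply, Matrix.cons_val]
      clear hx hy hz
      refine ⟨?_, ?_, ?_, ?_, ?_⟩ <;> omega
    · simp only [Finsupp.equivFunOnFinite_symm_apply_apply, Matrix.cons_val]
      congr 2
      clear hx hy hz
      omega

lemma card_tableaux_swap_one_two (D : Fin 5 → ℤ) :
    Nat.card (tableaux D) = Nat.card (tableaux ![D 0, D 2, D 1, D 3, D 4]) := by
  congr 2
  ext p
  simp [tableaux]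
  omega

lemma card_tableaux_cremona (D : Fin 5 → ℤ) :
    Nat.card (tableaux D) = Nat.card (tableaux (cremona4 D)) := by
  congr 2
  ext p
  simp [tableaux, cremona4, sigM4, Matrix.toLin'_apply, Matrix.mulVec, dotProduct,
    Fin.sum_univ_succ]
  omega

/-- The Bender–Knuth involution exchanging the letters `2` and `3`. -/
lemma card_tableaux_swap_two_three (D : Fin 5 → ℤ) :
    Nat.card (tableaux D) = Nat.card (tableaux ![D 0, D 1, D 3, D 2, D 4]) := by
  let f (s t : ℤ) (p : ℤ × ℤ) : ℤ × ℤ :=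
    (p.1 - max 0 (p.2 - (D 0 + t)) + max 0 (p.2 - (D 0 + s)), p.2)
  refine Nat.card_congr (Set.BijOn.equiv (f (D 2) (D 3))
    (Set.InvOn.bijOn (f' := f (D 3) (D 2)) ⟨?_, ?_⟩ ?_ ?_))
  · rintro ⟨u, v⟩ -
    ext <;> simp [f]
  · rintro ⟨u, v⟩ -
    ext <;> simp [f]
  all_goals
    rintro ⟨u, v⟩ h
    simp [tableaux, f] at h ⊢
    omega

/-- The Bender–Knuth involution exchanging the letters `3` and `4`. -/
lemma card_tableaux_swap_three_four (D : Fin 5 → ℤ) :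
    Nat.card (tableaux D) = Nat.card (tableaux ![D 0, D 1, D 2, D 4, D 3]) := by
  let f (s t : ℤ) (p : ℤ × ℤ) : ℤ × ℤ :=
    (p.1, p.2 - max p.1 (-t) + max p.1 (-s))
  refine Nat.card_congr (Set.BijOn.equiv (f (D 3) (D 4))
    (Set.InvOn.bijOn (f' := f (D 4) (D 3)) ⟨?_, ?_⟩ ?_ ?_))
  · rintro ⟨u, v⟩ -
    ext <;> simp [f]
  · rintro ⟨u, v⟩ -
    ext <;> simp [f]
  all_goals
    rintro ⟨u, v⟩ h
    simp [tableaux, f] at h ⊢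
    omega

lemma card_tableaux_comp_perm (π : Equiv.Perm (Fin 5)) (hπ : π 0 = 0) (D : Fin 5 → ℤ) :
    Nat.card (tableaux D) = Nat.card (tableaux (D ∘ π)) := by
  obtain ⟨⟨i, τ⟩, rfl⟩ := Equiv.Perm.decomposeFin.symm.surjective π
  obtain rfl : i = 0 := by simpa using hπ
  clear hπ
  have hτ : τ ∈ Submonoid.closure
      (Set.range fun i : Fin 3 => Equiv.swap i.castSucc i.succ) := by
    rw [Equiv.Perm.mclosure_swap_castSucc_succ]
    trivial
  have key : ∀ D : Fin 5 → ℤ, Nat.card (tableaux D) =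
      Nat.card (tableaux (Fin.cons (D 0) fun j => D (τ j).succ)) := by
    induction hτ using Submonoid.closure_induction with
    | one =>
      intro D
      congr 3
      ext j
      refine Fin.cases rfl (fun j => rfl) j
    | mul x y _ _ hx hy =>
      intro D
      rw [hx, hy]
      rfl
    | mem x hx =>
      obtain ⟨i, rfl⟩ := hx
      intro D
      fin_cases i
      · rw [card_tableaux_swap_one_two]
        congr 3
        ext j
        fin_cases j <;> rfl
      · rw [card_tableaux_swap_two_three]
        congr 3
        ext j
        fin_cases j <;> rfl
      · rw [card_tableaux_swap_three_four]
        congr 3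
        ext j
        fin_cases j <;> rfl
  rw [key]
  congr 3
  ext j
  refine Fin.cases ?_ (fun j => ?_) j <;> simp

/-- The multigraded Hilbert function of `R/M₄` is `W₄`-invariant. -/
theorem stmt9 {k : Type*} [Field k] (g : (Fin 5 → ℤ) ≃ₗ[ℤ] (Fin 5 → ℤ)) (hg : g ∈ W4)
    (D : Fin 5 → ℤ) :
    Module.finrank k (quotPiece (M4 k) deg4 D) =
      Module.finrank k (quotPiece (M4 k) deg4 (g D)) := by
  simp only [finrank_quotPiece_M4, card_stdMon]
  induction hg using Subgroup.closure_induction generalizing D with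
  | mem x hx =>
    rcases hx with rfl | ⟨π, hπ, rfl⟩
    · exact card_tableaux_cremona D
    · exact card_tableaux_comp_perm π hπ D
  | one => rfl
  | mul x y _ _ hx hy => exact (hy D).trans (hx (y D))
  | inv x _ hx =>
    have h := hx (x⁻¹ D)
    rw [show x (x⁻¹ D) = D from x.apply_symm_apply D] at h
    exact h.symm
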